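/- arXiv:2504.00760 — 3 statements merged into one kernel-verified Lean document; each statement's English description precedes it below -/
import Mathlib

section
/- Let (A,B) be a mixed-4-separation of a 4-connected graph G that satisfies the degree-condition. Then the following assertions are equivalent: (1) (A,B) is not a tetra-separation; (2) (A,B) is an atomic edge-cut in G; (3) |A \ B| = 1 or |B \ A| = 1. -/
open Set

namespace Paper

variable {V : Type*}

/-- The set of edges of `G` with one endvertex in `A \ B` and the other in `B \ A`. -/
def sepEdges (G : SimpleGraph V) (A B : Set V) : Set (Sym2 V) :=
  {e | e ∈ G.edgeSet ∧ ∃ a b : V, e = s(a, b) ∧ a ∈ A \ B ∧ b ∈ B \ A}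

/-- The order of the mixed-separation `(A, B)`: the number of vertices of `A ∩ B`
plus the number of edges between `A \ B` and `B \ A`. -/
noncomputable def sepOrder (G : SimpleGraph V) (A B : Set V) : ℕ∞ :=
  (A ∩ B).encard + (sepEdges G A B).encard

/-- A mixed-separation⁺: a pair of vertex sets covering the whole graph. -/
def IsMixedSepPlus (A B : Set V) : Prop := A ∪ B = Set.univ

/-- A (proper) mixed-separation. -/
def IsMixedSep (A B : Set V) : Prop :=
  A ∪ B = Set.univ ∧ (A \ B).Nonempty ∧ (B \ A).Nonempty

/-- `G` is `k`-connected: it has more than `k` vertices and deleting fewer than `k`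
vertices keeps it connected. -/
def KConnected (G : SimpleGraph V) (k : ℕ) : Prop :=
  (k : ℕ∞) < (Set.univ : Set V).encard ∧
    ∀ X : Set V, X.encard < (k : ℕ∞) → (G.induce (Xᶜ : Set V)).Connected

/-- Every vertex of `A ∩ B` has at least two neighbours in `A \ B`
and at least two neighbours in `B \ A`. -/
def DegreeCondition (G : SimpleGraph V) (A B : Set V) : Prop :=
  ∀ v ∈ A ∩ B,
    2 ≤ (G.neighborSet v ∩ (A \ B)).encard ∧ 2 ≤ (G.neighborSet v ∩ (B \ A)).encard

/-- No two edges in the separator of `(A,B)` share an endvertex. -/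
def MatchingCondition (G : SimpleGraph V) (A B : Set V) : Prop :=
  ∀ e ∈ sepEdges G A B, ∀ f ∈ sepEdges G A B, e ≠ f → ∀ v : V, v ∈ e → v ∉ f

/-- A tetra-separation. -/
def IsTetraSep (G : SimpleGraph V) (A B : Set V) : Prop :=
  IsMixedSep A B ∧ sepOrder G A B = 4 ∧ DegreeCondition G A B ∧ MatchingCondition G A B

/-- `(A,B) ≤ (C,D)`. -/
def LeSep (A B C D : Set V) : Prop := A ⊆ C ∧ D ⊆ B

/-- `(A,B)` and `(C,D)` are nested. -/
def Nested (A B C D : Set V) : Prop :=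
  LeSep A B C D ∨ LeSep A B D C ∨ LeSep B A C D ∨ LeSep B A D C

/-- `(A,B)` and `(C,D)` cross. -/
def Crosses (A B C D : Set V) : Prop := ¬ Nested A B C D

/-- The corner for the sides `A` and `C` of the pair `(A,B)`, `(C,D)`. -/
def corner (A B C D : Set V) : Set V := (A \ B) ∩ (C \ D)

/-- The vertex-centre of the crossing-diagram of `(A,B)` and `(C,D)`. -/
def vertexCentre (A B C D : Set V) : Set V := A ∩ B ∩ C ∩ D

/-- An edge is diagonal if its endvertices lie in opposite corners. -/
def IsDiagonal (G : SimpleGraph V) (A B C D : Set V) (e : Sym2 V) : Prop :=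
  e ∈ G.edgeSet ∧ ∃ a b : V, e = s(a, b) ∧
    ((a ∈ corner A B C D ∧ b ∈ corner B A D C) ∨
     (a ∈ corner A B D C ∧ b ∈ corner B A C D))

/-- The `C`-link of the crossing diagram of `(A,B)` and `(C,D)`: all non-diagonal
edges of `S(A,B)` with an endvertex in the corner for `AC` or for `BC`, together with
all vertices of `(C \ D) ∩ S(A,B)`.  (The `D`-link is `link G A B D C`, the `A`-link
is `link G C D A B`, the `B`-link is `link G C D B A`.) -/
def link (G : SimpleGraph V) (A B C D : Set V) : Set (V ⊕ Sym2 V) :=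
  Sum.inl '' ((C \ D) ∩ (A ∩ B)) ∪
    Sum.inr '' {e | e ∈ sepEdges G A B ∧ ¬ IsDiagonal G A B C D e ∧
      ∃ v : V, v ∈ e ∧ (v ∈ corner A B C D ∨ v ∈ corner B A C D)}

/-- The centre: the vertex-centre together with all diagonal edges. -/
def centre (G : SimpleGraph V) (A B C D : Set V) : Set (V ⊕ Sym2 V) :=
  Sum.inl '' vertexCentre A B C D ∪ Sum.inr '' {e | IsDiagonal G A B C D e}

/-- The corner-separator `L(A,C)`: the union of the `A`-link, the `C`-link, the
vertex-centre and the diagonal edges with an endvertex in the corner for `AC`. -/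
def cornerSep (G : SimpleGraph V) (A B C D : Set V) : Set (V ⊕ Sym2 V) :=
  link G C D A B ∪ link G A B C D ∪ Sum.inl '' vertexCentre A B C D ∪
    Sum.inr '' {e | IsDiagonal G A B C D e ∧ ∃ v : V, v ∈ e ∧ v ∈ corner A B C D}

/-- An edge is jumping if its endvertices lie in opposite links. -/
def IsJumping (G : SimpleGraph V) (A B C D : Set V) (e : Sym2 V) : Prop :=
  e ∈ G.edgeSet ∧ ∃ a b : V, e = s(a, b) ∧
    ((Sum.inl a ∈ link G C D A B ∧ Sum.inl b ∈ link G C D B A) ∨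
     (Sum.inl a ∈ link G A B C D ∧ Sum.inl b ∈ link G A B D C))

/-- An edge dangles from `fromLink` through `throughLink` if it has an endvertex
that is a vertex of `fromLink` and the edge itself is an element of `throughLink`. -/
def DanglesFromThrough (G : SimpleGraph V) (fromLink throughLink : Set (V ⊕ Sym2 V))
    (e : Sym2 V) : Prop :=
  e ∈ G.edgeSet ∧ (∃ v : V, v ∈ e ∧ Sum.inl v ∈ fromLink) ∧ Sum.inr e ∈ throughLink

/-- The corner for `A` and `C` is potter. -/
def Potter (G : SimpleGraph V) (A B C D : Set V) : Prop :=
  corner A B C D = ∅ ∧ (link G C D A B).encard = 2 ∧ (link G A B C D).encard = 2 ∧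
    ∃ u₁ u₂ u₃ u₄ : V, G.Adj u₁ u₂ ∧ G.Adj u₂ u₃ ∧ G.Adj u₃ u₄ ∧
      List.Nodup [u₁, u₂, u₃, u₄] ∧
      Sum.inl u₂ ∈ link G A B C D ∧ Sum.inr (s(u₁, u₂)) ∈ link G C D A B ∧
      Sum.inl u₃ ∈ link G C D A B ∧ Sum.inr (s(u₃, u₄)) ∈ link G A B C D

/-- All four links have size two and the centre is empty. -/
def LinksTwoCentreEmpty (G : SimpleGraph V) (A B C D : Set V) : Prop :=
  (link G C D A B).encard = 2 ∧ (link G C D B A).encard = 2 ∧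
    (link G A B C D).encard = 2 ∧ (link G A B D C).encard = 2 ∧
    centre G A B C D = ∅

/-- `(A,B)` is half-connected. -/
def HalfConnected (G : SimpleGraph V) (A B : Set V) : Prop :=
  (G.induce (A \ B)).Connected ∨ (G.induce (B \ A)).Connected

/-- First component of the left-reduction of `(A,B)`: delete from `A` the vertices of
`A ∩ B` with at most one neighbour in `A \ B`.  (The left-reduction of `(A,B)` is
`(leftRed G A B, B)`; the right-reduction is `(A, leftRed G B A)`.) -/
def leftRed (G : SimpleGraph V) (A B : Set V) : Set V :=
  A \ {v | v ∈ A ∩ B ∧ (G.neighborSet v ∩ (A \ B)).encard ≤ 1}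

/-- The separator of `(A,B)` as a set of vertices and edges. -/
def sepElems (G : SimpleGraph V) (A B : Set V) : Set (V ⊕ Sym2 V) :=
  Sum.inl '' (A ∩ B) ∪ Sum.inr '' sepEdges G A B

/-- `x̂`: the endvertices of an element of the separator. -/
def hat : V ⊕ Sym2 V → Set V
  | Sum.inl v => {v}
  | Sum.inr e => {w | w ∈ e}

/-- `X̂` for a set `X` of vertices and edges. -/
def hatSet (π : Set (V ⊕ Sym2 V)) : Set V := ⋃ x ∈ π, hat x

/-- Inner vertices of a walk. -/
def innerVerts (G : SimpleGraph V) {u v : V} (p : G.Walk u v) : Set V :=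
  {w | w ∈ p.support ∧ w ≠ u ∧ w ≠ v}

/-- An `X`–`Y` path: a path starting in `X`, ending in `Y`, with no other
vertex in `X ∪ Y`. -/
def IsXYPath (G : SimpleGraph V) (X Y : Set V) {u v : V} (p : G.Walk u v) : Prop :=
  p.IsPath ∧ u ∈ X ∧ v ∈ Y ∧ ∀ w ∈ p.support, w ∈ X ∪ Y → w = u ∨ w = v

/-- A walk avoids a vertex (it is not on the walk) or an edge (it is not used). -/
def WalkAvoids (G : SimpleGraph V) {u v : V} (p : G.Walk u v) (x : V ⊕ Sym2 V) : Prop :=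
  Sum.elim (fun w => w ∉ p.support) (fun e => e ∉ p.edges) x

/-- There are `n` pairwise independent `X`–`Y` paths in `G`
(no path contains an inner vertex of another). -/
def HasIndepPaths (G : SimpleGraph V) (X Y : Set V) (n : ℕ) : Prop :=
  ∃ (a b : Fin n → V) (p : ∀ i, G.Walk (a i) (b i)),
    (∀ i, IsXYPath G X Y (p i)) ∧
      ∀ i j, i ≠ j → ∀ w ∈ innerVerts G (p i), w ∉ (p j).support

/-- Maximum number of pairwise independent `X`–`Y` paths in `G`. -/
noncomputable def maxIndepPaths (G : SimpleGraph V) (X Y : Set V) : ℕ∞ :=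
  sSup {n : ℕ∞ | ∃ m : ℕ, n = (m : ℕ∞) ∧ HasIndepPaths G X Y m}

/-- `(A,B)` strongly separates `X` and `Y`. -/
def StronglySeparates (A B X Y : Set V) : Prop := X ⊆ A \ B ∧ Y ⊆ B \ A

/-- Minimum order of a mixed-separation of `G` strongly separating `X` and `Y`. -/
noncomputable def minSepOrder (G : SimpleGraph V) (X Y : Set V) : ℕ∞ :=
  sInf {n : ℕ∞ | ∃ A B : Set V,
    IsMixedSep A B ∧ StronglySeparates A B X Y ∧ sepOrder G A B = n}

/-- A `k`-separation: a mixed-separation of order `k` whose separator has no edges. -/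
def IsVertexSep (G : SimpleGraph V) (A B : Set V) (k : ℕ) : Prop :=
  IsMixedSep A B ∧ sepEdges G A B = ∅ ∧ sepOrder G A B = (k : ℕ∞)

/-- `G` is quasi-`k`-connected: `(k-1)`-connected and every `(k-1)`-separation has a
side whose proper part is a single vertex. -/
def QuasiConnected (G : SimpleGraph V) (k : ℕ) : Prop :=
  KConnected G (k - 1) ∧
    ∀ A B : Set V, IsVertexSep G A B (k - 1) →
      (A \ B).encard = 1 ∨ (B \ A).encard = 1

/-- `{x₁,x₂}` is 3-linked around the separator `{x₁,x₂,x₃,x₄}`. -/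
def ThreeLinkedAround (G : SimpleGraph V) (x₁ x₂ x₃ x₄ : V ⊕ Sym2 V) : Prop :=
  (∃ e : Sym2 V, x₃ = Sum.inr e) ∨ (∃ e : Sym2 V, x₄ = Sum.inr e) ∨
    (((∃ v : V, x₁ = Sum.inl v) ∨ (∃ v : V, x₂ = Sum.inl v)) ∧
      ∃ a b : V, G.Adj a b ∧ a ∈ hat x₁ ∧ b ∈ hat x₂) ∨
    (∃ (a b : Fin 3 → V) (p : ∀ i, G.Walk (a i) (b i)),
      (∀ i, IsXYPath G (hat x₁) (hat x₂) (p i) ∧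
        WalkAvoids G (p i) x₃ ∧ WalkAvoids G (p i) x₄) ∧
      ∀ i j, i ≠ j → ∀ w ∈ innerVerts G (p i), w ∉ (p j).support)

/-- `G` is 4-angry: 4-connected and every tetra-separation is crossed. -/
def FourAngry (G : SimpleGraph V) : Prop :=
  KConnected G 4 ∧
    ∀ A B : Set V, IsTetraSep G A B → ∃ C D : Set V, IsTetraSep G C D ∧ Crosses A B C D

/-- `G` is a sprinkled `K₄,ₘ`: a set `X` of four vertices, whose complement has
exactly `m` elements, is independent and completely joined to `X`
(edges inside `X` arbitrary). -/
def IsSprinkledK4m (G : SimpleGraph V) (m : ℕ∞) : Prop :=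
  ∃ X : Set V, X.encard = 4 ∧ (Xᶜ : Set V).encard = m ∧
    (∀ a b : V, a ∉ X → b ∉ X → ¬ G.Adj a b) ∧
    ∀ a : V, a ∉ X → ∀ x ∈ X, G.Adj a x

theorem sepEdges_comm (G : SimpleGraph V) (A B : Set V) : sepEdges G A B = sepEdges G B A := by
  ext e
  constructor <;>
  · rintro ⟨he, a, b, rfl, ha, hb⟩
    exact ⟨he, b, a, Sym2.eq_swap, hb, ha⟩

/-- In a `k`-connected graph, fewer than `k` vertices that meet every element of the separator
of `(A,B)` must contain one of the proper sides. -/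
theorem KConnected.diff_subset_or_diff_subset {G : SimpleGraph V} {k : ℕ} (hG : KConnected G k)
    {A B X : Set V} (hAB : A ∪ B = Set.univ) (hX : X.encard < (k : ℕ∞)) (hinter : A ∩ B ⊆ X)
    (hedges : ∀ a ∈ A \ B, ∀ b ∈ B \ A, G.Adj a b → a ∈ X ∨ b ∈ X) :
    A \ B ⊆ X ∨ B \ A ⊆ X := by
  by_contra! h
  obtain ⟨⟨a, haAB, haX⟩, b, hbBA, hbX⟩ := And.imp not_subset.mp not_subset.mp h
  obtain ⟨p⟩ := (hG.2 X hX).preconnected ⟨a, haX⟩ ⟨b, hbX⟩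
  have hclosed : ∀ u w : ↥(Xᶜ), (G.induce Xᶜ).Walk u w → (u : V) ∈ A \ B → (w : V) ∈ A \ B := by
    intro u w q
    induction q with
    | nil => exact id
    | @cons u w _ hadj _ ih =>
      intro hu
      refine ih ?_
      by_contra hw
      have hcov : (w : V) ∈ A ∪ B := hAB ▸ mem_univ _
      have hwX : (w : V) ∉ A ∩ B := fun h => w.2 (hinter h)
      have hwBA : (w : V) ∈ B \ A := by
        simp only [mem_union, mem_inter_iff, mem_sdiff] at *
        tauto
      exact (hedges u hu w hwBA hadj).elim u.2 w.2
  exact (hclosed _ _ p haAB).2 hbBA.1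

/-- If two separator edges of a mixed-4-separation of a 4-connected graph share an endvertex
in `A \ B`, then one of the proper sides is a single vertex. -/
theorem encard_diff_eq_one_of_shared_endvertex {G : SimpleGraph V} {A B : Set V}
    (hG : KConnected G 4) (hsep : IsMixedSep A B) (hord : sepOrder G A B = 4)
    {e f : Sym2 V} (he : e ∈ sepEdges G A B) (hf : f ∈ sepEdges G A B) (hef : e ≠ f)
    {v : V} (hv : v ∈ A \ B) (hve : v ∈ e) (hvf : v ∈ f) :
    (A \ B).encard = 1 ∨ (B \ A).encard = 1 := by
  obtain ⟨hAB, hA, hB⟩ := hsep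
  have one_of_le : ∀ {S : Set V}, S.Nonempty → S.encard ≤ 1 → S.encard = 1 :=
    fun hS h => le_antisymm h (one_le_encard_iff_nonempty.mpr hS)
  have encard_pair_le : ∀ x y : V, ({x, y} : Set V).encard ≤ 2 := fun x y =>
    (encard_insert_le _ _).trans (by rw [encard_singleton, one_add_one_eq_two])
  set R := sepEdges G A B \ {e, f}
  have hcount : (A ∩ B).encard + R.encard = 2 := by
    have hpair : R.encard + 2 = (sepEdges G A B).encard := by
      rw [← encard_pair hef]
      exact encard_sdiff_add_encard_of_subset (pair_subset he hf)
    have h4 : ((A ∩ B).encard + R.encard) + 2 = 2 + 2 := by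
      rw [add_assoc, hpair]
      exact hord.trans (by norm_num)
    exact ENat.add_left_injective_of_ne_top (n := 2) (by simp) h4
  have hR2 : R.encard ≤ 2 := hcount ▸ le_add_self
  -- An edge of the separator either has `v` as an endvertex or belongs to `R`.
  have hmem : ∀ a ∈ A \ B, ∀ b ∈ B \ A, G.Adj a b → a ≠ v → s(a, b) ∈ R := by
    refine fun a ha b hb hab hav => ⟨⟨hab, a, b, rfl, ha, hb⟩, ?_⟩
    have hvab : v ∉ s(a, b) := by
      rw [Sym2.mem_iff]
      rintro (rfl | rfl)
      exacts [hav rfl, hv.2 hb.1]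
    rintro (h | h)
    exacts [hvab (h ▸ hve), hvab (h ▸ hvf)]
  have hside : (A \ B).encard ≤ 1 ∨ (B \ A).encard ≤ R.encard := by
    have hend : ∀ g : Sym2 V, ∃ b : V, g ∈ R → b ∈ g ∧ b ∈ B \ A := by
      intro g
      by_cases hg : g ∈ R
      · obtain ⟨⟨-, a, b, rfl, -, hb⟩, -⟩ := hg
        exact ⟨b, fun _ => ⟨Sym2.mem_mk_right a b, hb⟩⟩
      · exact ⟨v, fun h => absurd h hg⟩
    choose c hc using hend
    have hX : ((A ∩ B) ∪ insert v (c '' R)).encard < ((4 : ℕ) : ℕ∞) := by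
      calc _ ≤ (A ∩ B).encard + (R.encard + 1) :=
            (encard_union_le _ _).trans (by
              gcongr
              exact (encard_insert_le _ _).trans (by gcongr; exact encard_image_le c R))
        _ = 3 := by rw [← add_assoc, hcount]; norm_num
        _ < _ := by norm_num
    rcases hG.diff_subset_or_diff_subset hAB hX subset_union_left (by
      intro a ha b hb hab
      by_cases hav : a = v
      · exact Or.inl (Or.inr (Or.inl hav))
      · have hg := hmem a ha b hb hab hav
        have hcg := hc _ hg
        have hcb : c s(a, b) = b := by
          rcases Sym2.mem_iff.mp hcg.1 with h | h
          · exact absurd (h ▸ hcg.2).1 ha.2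
          · exact h
        exact Or.inr (Or.inr (Or.inr ⟨_, hg, hcb⟩))) with h | h
    · left
      refine (encard_le_encard fun x hx => ?_).trans (encard_singleton v).le
      rcases h hx with h' | h' | ⟨g, hg, rfl⟩
      exacts [absurd h'.2 hx.2, h', absurd (hc g hg).2.1 hx.2]
    · right
      refine (encard_le_encard fun x hx => ?_).trans (encard_image_le c R)
      rcases h hx with h' | rfl | h'
      exacts [absurd h'.1 hx.2, absurd hx.1 hv.2, h']
  rcases hside with hle | hle
  · exact Or.inl (one_of_le hA hle)
  by_cases hR1 : R.encard ≤ 1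
  · exact Or.inr (one_of_le hB (hle.trans hR1))
  have hReq : R.encard = 2 :=
    le_antisymm hR2 (by simpa [one_add_one_eq_two] using Order.add_one_le_of_lt (not_le.mp hR1))
  have hinter : A ∩ B = ∅ := by
    rw [hReq] at hcount
    exact encard_eq_zero.mp (ENat.add_left_injective_of_ne_top (n := 2) (by simp)
      (hcount.trans (zero_add 2).symm))
  obtain ⟨g, g', -, hgg⟩ := encard_eq_two.mp hReq
  obtain ⟨⟨-, a, b, rfl, ha, hb⟩, -⟩ : g ∈ R := hgg ▸ mem_insert _ _
  obtain ⟨⟨-, a', b', rfl, ha', hb'⟩, -⟩ : g' ∈ R := hgg ▸ mem_insert_of_mem _ rfl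
  have hX : ({v, a, b'} : Set V).encard < ((4 : ℕ) : ℕ∞) := by
    refine lt_of_le_of_lt (b := 3) ?_ (by norm_num)
    refine (encard_insert_le _ _).trans ((add_le_add_left (encard_pair_le a b') 1).trans ?_)
    norm_num
  rcases hG.diff_subset_or_diff_subset hAB hX (by simp [hinter]) (by
    intro x hx y hy hxy
    by_cases hxv : x = v
    · exact Or.inl (Or.inl hxv)
    · have hg := hmem x hx y hy hxy hxv
      rw [hgg] at hg
      rcases hg with h | h
      · rcases Sym2.eq_iff.mp h with ⟨rfl, -⟩ | ⟨rfl, -⟩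
        · simp
        · exact absurd hb.1 hx.2
      · rcases Sym2.eq_iff.mp h with ⟨-, rfl⟩ | ⟨rfl, -⟩
        · simp
        · exact absurd hb'.1 hx.2) with h | h
  · exfalso
    have hAle : (A \ B).encard ≤ 2 := by
      refine (encard_le_encard fun x hx => ?_).trans (encard_pair_le v a)
      rcases h hx with rfl | rfl | rfl
      exacts [by simp, by simp, absurd hb'.1 hx.2]
    refine absurd hG.1 (not_lt.mpr ?_)
    have hcover : (Set.univ : Set V) = A \ B ∪ B \ A := by
      have hd : Disjoint A B := disjoint_iff_inter_eq_empty.mpr hinter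
      rw [hd.sdiff_eq_left, hd.sdiff_eq_right, hAB]
    rw [hcover]
    calc _ ≤ (A \ B).encard + (B \ A).encard := encard_union_le _ _
      _ ≤ 2 + 2 := add_le_add hAle (hle.trans hR2)
      _ = _ := by norm_num
  · right
    refine one_of_le hB ((encard_le_encard fun x hx => ?_).trans (encard_singleton b').le)
    rcases h hx with rfl | rfl | h'
    exacts [absurd hx.1 hv.2, absurd ha.1 hx.2, h']

/-- If `A \ B` is a single vertex and every vertex of `A ∩ B` has two neighbours in `A \ B`,
then `A ∩ B` is empty. -/
theorem DegreeCondition.inter_eq_empty {G : SimpleGraph V} {A B : Set V}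
    (hdeg : DegreeCondition G A B) (h : (A \ B).encard = 1 ∨ (B \ A).encard = 1) :
    A ∩ B = ∅ := by
  refine eq_empty_of_forall_notMem fun v hv => ?_
  obtain ⟨h₁, h₂⟩ := hdeg v hv
  rcases h with h | h
  · have := h₁.trans ((encard_le_encard inter_subset_right).trans h.le)
    norm_num at this
  · have := h₂.trans ((encard_le_encard inter_subset_right).trans h.le)
    norm_num at this

/-- A mixed-4-separation with a one-vertex side and empty vertex separator violates the
matching-condition. -/
theorem not_matchingCondition_of_inter_eq_empty {G : SimpleGraph V} {A B : Set V}
    (hord : sepOrder G A B = 4) (hinter : A ∩ B = ∅) (h : A.encard = 1 ∨ B.encard = 1) :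
    ¬ MatchingCondition G A B := by
  intro hM
  have hcard : (sepEdges G A B).encard = 4 := by simpa [sepOrder, hinter] using hord
  obtain ⟨e, he, f, hf, hef⟩ : ∃ e ∈ sepEdges G A B, ∃ f ∈ sepEdges G A B, e ≠ f := by
    have h1 : 1 < (sepEdges G A B).encard := by rw [hcard]; norm_num
    obtain ⟨e, f, he, hf, hef⟩ := one_lt_encard_iff.mp h1
    exact ⟨e, he, f, hf, hef⟩
  have hdisj := hM e he f hf hef
  obtain ⟨-, a, b, rfl, ha, hb⟩ := he
  obtain ⟨-, a', b', rfl, ha', hb'⟩ := hf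
  rcases h with h | h
  · have haa : a = a' := encard_le_one_iff.mp h.le a a' ha.1 ha'.1
    exact hdisj a (by simp) (by simp [haa])
  · have hbb : b = b' := encard_le_one_iff.mp h.le b b' hb.1 hb'.1
    exact hdisj b (by simp) (by simp [hbb])

/-- characterisation of mixed-4-separations with the degree-condition
that fail to be tetra-separations. -/
theorem trivial_tetra_separations (G : SimpleGraph V) (A B : Set V)
    (hG : KConnected G 4) (hsep : IsMixedSep A B) (hord : sepOrder G A B = 4)
    (hdeg : DegreeCondition G A B) :
    (¬ IsTetraSep G A B ↔
      (IsMixedSep A B ∧ A ∩ B = ∅ ∧ (A.encard = 1 ∨ B.encard = 1))) ∧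
    ((IsMixedSep A B ∧ A ∩ B = ∅ ∧ (A.encard = 1 ∨ B.encard = 1)) ↔
      ((A \ B).encard = 1 ∨ (B \ A).encard = 1)) := by
  have hcut : (IsMixedSep A B ∧ A ∩ B = ∅ ∧ (A.encard = 1 ∨ B.encard = 1)) ↔
      ((A \ B).encard = 1 ∨ (B \ A).encard = 1) := by
    have hsides : A ∩ B = ∅ → A \ B = A ∧ B \ A = B := fun h =>
      have hd : Disjoint A B := disjoint_iff_inter_eq_empty.mpr h
      ⟨hd.sdiff_eq_left, hd.sdiff_eq_right⟩
    constructor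
    · rintro ⟨-, hinter, h⟩
      rwa [(hsides hinter).1, (hsides hinter).2]
    · intro h
      have hinter := hdeg.inter_eq_empty h
      rw [(hsides hinter).1, (hsides hinter).2] at h
      exact ⟨hsep, hinter, h⟩
  refine ⟨⟨fun hT => hcut.mpr ?_, fun ⟨_, hinter, h⟩ hT =>
    not_matchingCondition_of_inter_eq_empty hord hinter h hT.2.2.2⟩, hcut⟩
  have hM : ¬ MatchingCondition G A B := fun hM => hT ⟨hsep, hord, hdeg, hM⟩
  simp only [MatchingCondition, not_forall, not_not] at hM
  obtain ⟨e, he, f, hf, hef, v, hve, hvf⟩ := hM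
  have hv : v ∈ A \ B ∨ v ∈ B \ A := by
    obtain ⟨-, a, b, rfl, ha, hb⟩ := he
    rcases Sym2.mem_iff.mp hve with rfl | rfl
    exacts [Or.inl ha, Or.inr hb]
  rcases hv with hv | hv
  · exact encard_diff_eq_one_of_shared_endvertex hG hsep hord he hf hef hv hve hvf
  · have hord' : sepOrder G B A = 4 := by
      rwa [sepOrder, inter_comm, sepEdges_comm]
    rw [sepEdges_comm] at he hf
    exact (encard_diff_eq_one_of_shared_endvertex hG
      ⟨union_comm A B ▸ hsep.1, hsep.2.2, hsep.2.1⟩ hord' he hf hef hv hve hvf).symm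
end Paper
end

section
/- Let k be a natural number and let G be a quasi-(k+1)-connected graph with at least k+4 vertices. Then G has no mixed-k-separation (A,B) with |A \ B| ≥ 2 and |B \ A| ≥ 2. -/
open Set

namespace Paper

variable {V : Type*}

/-- In a `k`-connected graph, every mixed-separation whose separator has no edges has order
at least `k`. -/
theorem KConnected.le_encard_inter {G : SimpleGraph V} {k : ℕ} (hG : KConnected G k)
    {A B : Set V} (hsep : IsMixedSep A B) (hE : sepEdges G A B = ∅) :
    (k : ℕ∞) ≤ (A ∩ B).encard := by
  by_contra! hlt
  obtain ⟨hAB, ⟨a, ha⟩, ⟨b, hb⟩⟩ := hsep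
  obtain ⟨p⟩ := (hG.2 _ hlt).preconnected ⟨a, fun h => ha.2 h.2⟩ ⟨b, fun h => hb.2 h.1⟩
  obtain ⟨d, -, hd₁, hd₂⟩ := p.exists_boundary_dart {x | x.1 ∈ A \ B} ha fun h => hb.2 h.1
  have hd₃ : d.snd.1 ∈ B \ A := by
    have hc := d.snd.2
    have hu : d.snd.1 ∈ A ∪ B := hAB ▸ mem_univ _
    simp only [mem_compl_iff, mem_inter_iff, mem_union, mem_ofPred_eq, mem_sdiff] at *
    tauto
  have : s(d.fst.1, d.snd.1) ∈ sepEdges G A B := ⟨d.adj, _, _, rfl, hd₁, hd₃⟩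
  simp [hE] at this

/-- A quasi-`(k+1)`-connected graph has no edgeless mixed-separation of order at most `k` both of
whose proper sides have at least two vertices. -/
theorem QuasiConnected.lt_encard_inter {G : SimpleGraph V} {k : ℕ}
    (hG : QuasiConnected G (k + 1)) {A B : Set V} (hAB : A ∪ B = univ)
    (hE : sepEdges G A B = ∅) (hA : 2 ≤ (A \ B).encard) (hB : 2 ≤ (B \ A).encard) :
    (k : ℕ∞) < (A ∩ B).encard := by
  have hsep : IsMixedSep A B :=
    ⟨hAB, encard_pos.1 (two_pos.trans_le hA), encard_pos.1 (two_pos.trans_le hB)⟩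
  refine (hG.1.le_encard_inter hsep hE).lt_of_ne fun h => ?_
  rcases hG.2 A B ⟨hsep, hE, by simp [sepOrder, hE, ← h]⟩ with h1 | h1
  · simp [h1] at hA
  · simp [h1] at hB

/-- In a quasi-`(k+1)`-connected graph, replacing the edges of the separator of a
mixed-separation by a vertex cover of them that leaves at least two vertices on each proper side
yields more than `k` vertices. -/
theorem QuasiConnected.lt_encard_cover {G : SimpleGraph V} {k : ℕ}
    (hG : QuasiConnected G (k + 1)) {A B X Y : Set V} (hAB : A ∪ B = univ)
    (hX : X ⊆ A \ B) (hY : Y ⊆ B \ A)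
    (hcover : ∀ a ∈ A \ B, ∀ b ∈ B \ A, G.Adj a b → a ∈ X ∨ b ∈ Y)
    (hA : 2 ≤ ((A \ B) \ X).encard) (hB : 2 ≤ ((B \ A) \ Y).encard) :
    (k : ℕ∞) < (A ∩ B).encard + (X.encard + Y.encard) := by
  have hl : (A ∪ Y) \ (B ∪ X) = (A \ B) \ X := by
    ext v; have := @hY v; simp only [mem_sdiff, mem_union] at *; tauto
  have hr : (B ∪ X) \ (A ∪ Y) = (B \ A) \ Y := by
    ext v; have := @hX v; simp only [mem_sdiff, mem_union] at *; tauto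
  have hS : (A ∪ Y) ∩ (B ∪ X) ⊆ (A ∩ B) ∪ (X ∪ Y) := by
    intro v; simp only [mem_inter_iff, mem_union]; tauto
  have hE : sepEdges G (A ∪ Y) (B ∪ X) = ∅ := by
    refine eq_empty_of_forall_notMem ?_
    rintro _ ⟨hadj, a, b, rfl, ha, hb⟩
    rw [hl] at ha
    rw [hr] at hb
    exact (hcover a ha.1 b hb.1 hadj).elim ha.2 hb.2
  calc (k : ℕ∞) < ((A ∪ Y) ∩ (B ∪ X)).encard :=
        hG.lt_encard_inter
          (univ_subset_iff.1 (hAB ▸ union_subset_union subset_union_left subset_union_left)) hE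
          (hl ▸ hA) (hr ▸ hB)
    _ ≤ ((A ∩ B) ∪ (X ∪ Y)).encard := encard_le_encard hS
    _ ≤ _ := (encard_union_le _ _).trans (by gcongr; exact encard_union_le _ _)

/-- Any set `X` of left endvertices of edges of a separator extends, by right endvertices, to a
vertex cover with at most as many vertices as there are edges, and by none if `X` is already a cover. -/
theorem exists_cover_encard_le (G : SimpleGraph V) {A B X : Set V} (hX : X ⊆ A \ B)
    (hXE : ∀ a ∈ X, ∃ b ∈ B \ A, G.Adj a b) :
    ∃ Y ⊆ B \ A, (∀ a ∈ A \ B, ∀ b ∈ B \ A, G.Adj a b → a ∈ X ∨ b ∈ Y) ∧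
      X.encard + Y.encard ≤ (sepEdges G A B).encard ∧
      ((∀ a ∈ A \ B, ∀ b ∈ B \ A, G.Adj a b → a ∈ X) → Y = ∅) := by
  set P : Set (V × V) := {p | p.1 ∈ A \ B ∧ p.2 ∈ B \ A ∧ G.Adj p.1 p.2}
  have hinj : InjOn (fun p : V × V => s(p.1, p.2)) P := by
    rintro ⟨a, b⟩ ⟨ha, hb, -⟩ ⟨c, d⟩ ⟨hc, hd, -⟩ h
    rcases Sym2.eq_iff.1 h with ⟨h₁, h₂⟩ | ⟨h₁, -⟩
    · exact Prod.ext h₁ h₂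
    · dsimp only at ha hd h₁
      exact absurd (h₁ ▸ ha.1) hd.2
  have himage : (fun p : V × V => s(p.1, p.2)) '' P ⊆ sepEdges G A B := by
    rintro _ ⟨⟨a, b⟩, ⟨ha, hb, hadj⟩, rfl⟩
    exact ⟨hadj, a, b, rfl, ha, hb⟩
  refine ⟨Prod.snd '' {p ∈ P | p.1 ∉ X}, ?_, ?_, ?_, ?_⟩
  · rintro _ ⟨p, ⟨⟨-, hp, -⟩, -⟩, rfl⟩
    exact hp
  · intro a ha b hb hadj
    by_cases h : a ∈ X
    · exact .inl h
    · exact .inr ⟨(a, b), ⟨⟨ha, hb, hadj⟩, h⟩, rfl⟩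
  · have hXsub : X ⊆ Prod.fst '' {p ∈ P | p.1 ∈ X} := by
      intro a ha
      obtain ⟨b, hb, hadj⟩ := hXE a ha
      exact ⟨(a, b), ⟨⟨hX ha, hb, hadj⟩, ha⟩, rfl⟩
    have hdisj : Disjoint {p ∈ P | p.1 ∈ X} {p ∈ P | p.1 ∉ X} :=
      disjoint_left.2 fun p hp hp' => hp'.2 hp.2
    calc X.encard + (Prod.snd '' {p ∈ P | p.1 ∉ X}).encard
        ≤ {p ∈ P | p.1 ∈ X}.encard + {p ∈ P | p.1 ∉ X}.encard :=
          add_le_add ((encard_le_encard hXsub).trans (encard_image_le _ _)) (encard_image_le _ _)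
      _ = ({p ∈ P | p.1 ∈ X} ∪ {p ∈ P | p.1 ∉ X}).encard := (encard_union_eq hdisj).symm
      _ ≤ P.encard := encard_le_encard (union_subset (sep_subset _ _) (sep_subset _ _))
      _ = ((fun p : V × V => s(p.1, p.2)) '' P).encard := hinj.encard_image.symm
      _ ≤ _ := encard_le_encard himage
  · intro h
    refine image_eq_empty.2 (eq_empty_of_forall_notMem ?_)
    rintro p ⟨⟨ha, hb, hadj⟩, hp⟩
    exact hp (h _ ha _ hb hadj)

/-- a quasi-(k+1)-connected graph with at least k+4 vertices has no
mixed-k-separation with both proper sides of size at least 2. -/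
theorem quasi_connected_no_mixed_k_separation (G : SimpleGraph V) (k : ℕ)
    (hG : QuasiConnected G (k + 1))
    (hcard : (k : ℕ∞) + 4 ≤ (Set.univ : Set V).encard) :
    ¬ ∃ A B : Set V, IsMixedSep A B ∧ sepOrder G A B = (k : ℕ∞) ∧
        2 ≤ (A \ B).encard ∧ 2 ≤ (B \ A).encard := by
  rintro ⟨A, B, ⟨hAB, -, -⟩, hord, hA, hB⟩
  set L : Set V := {a ∈ A \ B | ∃ b ∈ B \ A, G.Adj a b}
  have hno_cover : ∀ X Y : Set V, X ⊆ A \ B → Y ⊆ B \ A →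
      (∀ a ∈ A \ B, ∀ b ∈ B \ A, G.Adj a b → a ∈ X ∨ b ∈ Y) →
      X.encard + Y.encard ≤ (sepEdges G A B).encard →
      2 ≤ ((A \ B) \ X).encard → ¬ 2 ≤ ((B \ A) \ Y).encard := by
    intro X Y hX hY hcover hle hX2 hY2
    refine (hG.lt_encard_cover hAB hX hY hcover hX2 hY2).not_ge ?_
    rw [← hord, sepOrder]
    gcongr
  by_cases hL : 2 ≤ ((A \ B) \ L).encard
  · obtain ⟨Y, hY, hcover, hle, hempty⟩ :=
      exists_cover_encard_le G (X := L) (sep_subset _ _) fun a ha => ha.2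
    refine hno_cover L Y (sep_subset _ _) hY hcover hle hL ?_
    rwa [hempty fun a ha b hb hadj => ⟨ha, b, hb, hadj⟩, sdiff_empty]
  · obtain ⟨T, hLT, hTA, hT⟩ := exists_superset_subset_encard_eq
      (sdiff_subset : (A \ B) \ L ⊆ A \ B) (not_le.1 hL).le hA
    obtain ⟨Y, hY, hcover, hle, -⟩ :=
      exists_cover_encard_le G (A := A) (B := B) (X := (A \ B) \ T) sdiff_subset fun a ha =>
        (not_not.1 fun h => ha.2 (hLT ⟨ha.1, h⟩) : a ∈ L).2
    refine hno_cover _ Y sdiff_subset hY hcover hle ?_ ?_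
    · rw [sdiff_sdiff_cancel_left hTA, hT]
    · have huniv : (univ : Set V) = (A ∩ B) ∪ ((A \ B) ∪ (B \ A)) := by
        ext v
        have : v ∈ A ∪ B := hAB ▸ mem_univ v
        simp only [mem_univ, mem_union, mem_inter_iff, mem_sdiff] at *
        tauto
      have hV : (k : ℕ∞) + 4 ≤ (A ∩ B).encard + ((A \ B).encard + (B \ A).encard) := by
        refine hcard.trans (huniv ▸ (encard_union_le _ _).trans ?_)
        gcongr
        exact encard_union_le _ _
      rw [← encard_sdiff_add_encard_of_subset hTA,
        ← encard_sdiff_add_encard_of_subset hY, hT] at hV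
      rw [sepOrder] at hord
      generalize ((B \ A) \ Y).encard = r at *
      generalize ((A \ B) \ T).encard = x at *
      generalize Y.encard = y at *
      generalize (A ∩ B).encard = c at *
      generalize (sepEdges G A B).encard = m at *
      have hm : m ≠ ⊤ := by rintro rfl; simp at hord
      have hc : c ≠ ⊤ := by rintro rfl; simp at hord
      have hx : x ≠ ⊤ := by rintro rfl; simp_all
      have hy : y ≠ ⊤ := by rintro rfl; simp_all
      lift m to ℕ using hm
      lift c to ℕ using hc
      lift x to ℕ using hx
      lift y to ℕ using hy
      induction r using ENat.recTopCoe with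
      | top => exact le_top
      | coe r =>
        norm_cast at *
        omega
end Paper
end

section
/- Let (A,B) and (C,D) be two crossing tetra-separations in a 4-connected graph G. Then there exist two opposite corner-separators of size at least 4. -/
open Set

namespace Paper

variable {V : Type*}

theorem mk_mem_sepEdges {G : SimpleGraph V} {A B : Set V} {a b : V} (h : G.Adj a b)
    (ha : a ∈ A \ B) (hb : b ∈ B \ A) : s(a, b) ∈ sepEdges G A B :=
  ⟨h, a, b, rfl, ha, hb⟩

/-- If both strict sides are completely joined, the separation has order at least `|V| - 1`. -/
theorem encard_univ_le_of_complete {G : SimpleGraph V} {A B : Set V} (h : IsMixedSep A B)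
    (hadj : ∀ v ∈ A \ B, ∀ w ∈ B \ A, G.Adj v w) :
    (Set.univ : Set V).encard ≤ sepOrder G A B + 1 := by
  obtain ⟨hU, ⟨v, hv⟩, ⟨w, hw⟩⟩ := h
  have hinj₁ : InjOn (fun a : V => s(a, w)) (A \ B) :=
    fun x _ y _ hxy => Sym2.congr_left.1 hxy
  have hinj₂ : InjOn (fun b : V => s(v, b)) ((B \ A) \ {w}) :=
    fun x _ y _ hxy => Sym2.congr_right.1 hxy
  have hdisj : Disjoint ((fun a : V => s(a, w)) '' (A \ B))
      ((fun b : V => s(v, b)) '' ((B \ A) \ {w})) := by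
    rw [Set.disjoint_left]
    rintro _ ⟨a, ha, rfl⟩ ⟨b, hb, hab⟩
    rcases Sym2.eq_iff.1 hab with ⟨-, h⟩ | ⟨h, -⟩
    · exact hb.2 h
    · exact hv.2 (h ▸ hw.1)
  have hsub : (fun a : V => s(a, w)) '' (A \ B) ∪ (fun b : V => s(v, b)) '' ((B \ A) \ {w}) ⊆
      sepEdges G A B := by
    rintro _ (⟨a, ha, rfl⟩ | ⟨b, hb, rfl⟩)
    · exact mk_mem_sepEdges (hadj a ha w hw) ha hw
    · exact mk_mem_sepEdges (hadj v hv b hb.1) hv hb.1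
  have hcard := Set.encard_le_encard hsub
  rw [Set.encard_union_eq hdisj, hinj₁.encard_image, hinj₂.encard_image] at hcard
  have huniv : (Set.univ : Set V) = (A ∩ B) ∪ ((A \ B) ∪ (B \ A)) := by
    rw [← hU]; ext x; simp only [mem_union, mem_inter_iff, mem_sdiff]; tauto
  calc (Set.univ : Set V).encard
      ≤ (A ∩ B).encard + ((A \ B).encard + (B \ A).encard) := by
        rw [huniv]
        exact (Set.encard_union_le _ _).trans (by gcongr; exact Set.encard_union_le _ _)
    _ = (A ∩ B).encard + ((A \ B).encard + ((B \ A) \ {w}).encard + 1) := by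
        rw [← Set.encard_sdiff_singleton_add_one hw, add_assoc]
    _ ≤ (A ∩ B).encard + ((sepEdges G A B).encard + 1) := by gcongr
    _ = sepOrder G A B + 1 := by rw [sepOrder, add_assoc]

/-- In a `k`-connected graph every mixed-separation has order at least `k`. -/
theorem KConnected.le_sepOrder {G : SimpleGraph V} {k : ℕ} {A B : Set V} (hG : KConnected G k)
    (h : IsMixedSep A B) : (k : ℕ∞) ≤ sepOrder G A B := by
  by_contra! hlt
  by_cases hadj : ∀ v ∈ A \ B, ∀ w ∈ B \ A, G.Adj v w
  · exact absurd hG.1 (not_lt.2 ((encard_univ_le_of_complete h hadj).trans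
      (Order.add_one_le_of_lt hlt)))
  push Not at hadj
  obtain ⟨v, hv, w, hw, hvw⟩ := hadj
  have hend : ∀ e ∈ sepEdges G A B, ∃ x ∈ e, x ≠ v ∧ x ≠ w := by
    rintro _ ⟨he, a, b, rfl, ha, hb⟩
    by_cases hav : a = v
    · refine ⟨b, Sym2.mem_mk_right a b, fun hbv => hb.2 (hbv ▸ hv.1), ?_⟩
      rintro rfl
      exact hvw (hav ▸ he)
    · exact ⟨a, Sym2.mem_mk_left a b, hav, fun haw => hw.2 (haw ▸ ha.1)⟩
  have : Nonempty V := ⟨v⟩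
  choose! f hfe hfv hfw using hend
  have hX : (A ∩ B ∪ f '' sepEdges G A B).encard < (k : ℕ∞) := by
    refine lt_of_le_of_lt ((Set.encard_union_le _ _).trans ?_) hlt
    unfold sepOrder
    gcongr
    exact Set.encard_image_le _ _
  have hvX : v ∈ (A ∩ B ∪ f '' sepEdges G A B)ᶜ := by
    rintro (h | ⟨e, he, h⟩)
    · exact hv.2 h.2
    · exact hfv e he h
  have hwX : w ∈ (A ∩ B ∪ f '' sepEdges G A B)ᶜ := by
    rintro (h | ⟨e, he, h⟩)
    · exact hw.2 h.1
    · exact hfw e he h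
  obtain ⟨p⟩ := (hG.2 _ hX).preconnected ⟨v, hvX⟩ ⟨w, hwX⟩
  obtain ⟨d, -, hd₁, hd₂⟩ := p.exists_boundary_dart {x | x.1 ∈ A \ B} hv (fun h => hw.2 h.1)
  have hsnd : d.snd.1 ∈ B \ A := by
    have hAB : d.snd.1 ∈ A ∪ B := h.1 ▸ mem_univ _
    have hX' : d.snd.1 ∉ A ∩ B := fun h => d.snd.2 (Or.inl h)
    simp only [mem_ofPred_eq, mem_sdiff, mem_union, mem_inter_iff] at *
    tauto
  have he : s(d.fst.1, d.snd.1) ∈ sepEdges G A B := mk_mem_sepEdges d.adj hd₁ hsnd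
  rcases Sym2.mem_iff.1 (hfe _ he) with h | h
  · exact d.fst.2 (Or.inr ⟨_, he, h⟩)
  · exact d.snd.2 (Or.inr ⟨_, he, h⟩)

theorem encard_sepElems (G : SimpleGraph V) (A B : Set V) :
    (sepElems G A B).encard = sepOrder G A B := by
  rw [sepElems, Set.encard_union_eq, Sum.inl_injective.encard_image,
    Sum.inr_injective.encard_image, sepOrder]
  rw [Set.disjoint_left]
  rintro _ ⟨x, -, rfl⟩ ⟨y, -, h⟩
  cases h

theorem isDiagonal_comm (G : SimpleGraph V) (A B C D : Set V) (e : Sym2 V) :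
    IsDiagonal G A B C D e ↔ IsDiagonal G C D A B e := by
  have key : ∀ A B C D : Set V, IsDiagonal G A B C D e → IsDiagonal G C D A B e := by
    rintro A B C D ⟨he, a, b, rfl, h | h⟩
    · exact ⟨he, a, b, rfl, Or.inl ⟨h.1.symm, h.2.symm⟩⟩
    · exact ⟨he, b, a, Sym2.eq_swap, Or.inr ⟨h.2.symm, h.1.symm⟩⟩
  exact ⟨key A B C D, key C D A B⟩

theorem cornerSep_comm (G : SimpleGraph V) (A B C D : Set V) :
    cornerSep G A B C D = cornerSep G C D A B := by
  have hcorner : corner A B C D = corner C D A B := inter_comm _ _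
  have hcentre : vertexCentre A B C D = vertexCentre C D A B := by
    unfold vertexCentre; ext x; simp only [mem_inter_iff]; tauto
  unfold cornerSep
  rw [union_comm (link G C D A B), hcorner, hcentre]
  simp only [isDiagonal_comm G A B C D]

/-- The corner-separator contains the separator of the mixed-separation cutting off the corner. -/
theorem sepElems_subset_cornerSep {G : SimpleGraph V} {A B C D : Set V} (hAB : A ∪ B = univ)
    (hCD : C ∪ D = univ) : sepElems G (A ∩ C) (B ∪ D) ⊆ cornerSep G A B C D := by
  have hA : ∀ x, x ∈ A ∨ x ∈ B := fun x => (hAB ▸ mem_univ x : x ∈ A ∪ B)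
  have hC : ∀ x, x ∈ C ∨ x ∈ D := fun x => (hCD ▸ mem_univ x : x ∈ C ∪ D)
  rintro _ (⟨x, hx, rfl⟩ | ⟨_, ⟨he, a, b, rfl, ha, hb⟩, rfl⟩)
  · simp only [cornerSep, link, vertexCentre, mem_union, mem_image, mem_inter_iff, mem_sdiff,
      Sum.inl.injEq, exists_eq_right, reduceCtorEq, and_false, exists_false, or_false] at hx ⊢
    tauto
  · have hac : a ∈ corner A B C D := by
      simp only [corner, mem_union, mem_inter_iff, mem_sdiff] at ha ⊢; tauto
    by_cases hdiag : IsDiagonal G A B C D s(a, b)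
    · exact Or.inr ⟨_, ⟨hdiag, a, Sym2.mem_mk_left a b, hac⟩, rfl⟩
    · by_cases hbA : b ∈ A
      · have hbC : b ∉ C := fun h => hb.2 ⟨hbA, h⟩
        refine Or.inl (Or.inl (Or.inl (Or.inr ⟨_, ⟨mk_mem_sepEdges he hac.2
          ⟨(hC b).resolve_left hbC, hbC⟩, ?_, a, Sym2.mem_mk_left a b, Or.inl hac.symm⟩, rfl⟩)))
        rwa [← isDiagonal_comm]
      · exact Or.inl (Or.inl (Or.inr (Or.inr ⟨_, ⟨mk_mem_sepEdges he hac.1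
          ⟨(hA b).resolve_left hbA, hbA⟩, hdiag, a, Sym2.mem_mk_left a b, Or.inl hac⟩, rfl⟩)))

/-- The corner-separator of a nonempty corner of a `k`-connected graph has size at least `k`. -/
theorem KConnected.le_encard_cornerSep {G : SimpleGraph V} {k : ℕ} {A B C D : Set V}
    (hG : KConnected G k) (hAB : IsMixedSep A B) (hCD : IsMixedSep C D)
    (hne : (corner A B C D).Nonempty) : (k : ℕ∞) ≤ (cornerSep G A B C D).encard := by
  have hsep : IsMixedSep (A ∩ C) (B ∪ D) := by
    refine ⟨?_, ?_, ?_⟩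
    · ext x
      have h₁ : x ∈ A ∪ B := hAB.1 ▸ mem_univ x
      have h₂ : x ∈ C ∪ D := hCD.1 ▸ mem_univ x
      simp only [mem_union, mem_inter_iff, mem_univ, iff_true] at *
      tauto
    · obtain ⟨x, hx⟩ := hne
      exact ⟨x, ⟨hx.1.1, hx.2.1⟩, fun h => h.elim hx.1.2 hx.2.2⟩
    · obtain ⟨x, hx⟩ := hAB.2.2
      exact ⟨x, Or.inl hx.1, fun h => hx.2 h.1⟩
  calc (k : ℕ∞) ≤ sepOrder G (A ∩ C) (B ∪ D) := hG.le_sepOrder hsep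
    _ = (sepElems G (A ∩ C) (B ∪ D)).encard := (encard_sepElems _ _ _).symm
    _ ≤ _ := Set.encard_le_encard (sepElems_subset_cornerSep hAB.1 hCD.1)

/-- If both corners at `A` are empty, their corner-separators still have size at least four. -/
theorem four_le_encard_cornerSep_of_corners_empty {G : SimpleGraph V} {A B C D : Set V}
    (hAB : IsTetraSep G A B) (hCD : IsTetraSep G C D) (hAC : corner A B C D = ∅)
    (hAD : corner A B D C = ∅) : 4 ≤ (cornerSep G A B C D).encard := by
  classical
  have hA : ∀ x, x ∈ A ∨ x ∈ B := fun x => (hAB.1.1 ▸ mem_univ x : x ∈ A ∪ B)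
  have hC : ∀ x, x ∈ C ∨ x ∈ D := fun x => (hCD.1.1 ▸ mem_univ x : x ∈ C ∪ D)
  have hside : ∀ x ∈ A \ B, x ∈ C ∩ D := fun x hx => by
    have h₁ : x ∉ corner A B C D := hAC ▸ notMem_empty x
    have h₂ : x ∉ corner A B D C := hAD ▸ notMem_empty x
    have h₃ := hC x
    simp only [corner, mem_inter_iff, mem_sdiff] at *
    tauto
  obtain ⟨v, hv⟩ := hAB.1.2.1
  have hN := (hCD.2.2.1 v (hside v hv)).1
  obtain ⟨u, hu, huA⟩ : ∃ u ∈ G.neighborSet v ∩ (C \ D), u ∈ A := by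
    by_contra! hcon
    have hlt : (1 : ℕ∞) < (G.neighborSet v ∩ (C \ D)).encard :=
      lt_of_lt_of_le (by norm_num) hN
    obtain ⟨x, y, hx, hy, hxy⟩ := Set.one_lt_encard_iff.1 hlt
    have hxe := mk_mem_sepEdges hx.1 hv ⟨(hA x).resolve_left (hcon x hx), hcon x hx⟩
    have hye := mk_mem_sepEdges hy.1 hv ⟨(hA y).resolve_left (hcon y hy), hcon y hy⟩
    exact hAB.2.2.2 _ hxe _ hye (fun h => hxy (Sym2.congr_right.1 h)) v
      (Sym2.mem_mk_left v x) (Sym2.mem_mk_left v y)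
  have huB : u ∈ B := by
    by_contra huB
    exact hu.2.2 (hside u ⟨huA, huB⟩).2
  have hM := (hAB.2.2.1 u ⟨huA, huB⟩).1
  let f : V → V ⊕ Sym2 V := fun x => if x ∈ A then Sum.inl x else Sum.inr s(v, x)
  have hf : Function.Injective f := by
    intro x y hxy
    simp only [f] at hxy
    split_ifs at hxy
    · exact Sum.inl_injective hxy
    · exact Sym2.congr_right.1 (Sum.inr_injective hxy)
  have hfsub : f '' (G.neighborSet v ∩ (C \ D)) ⊆ link G A B C D := by
    rintro _ ⟨x, hx, rfl⟩
    by_cases hxA : x ∈ A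
    · have hxB : x ∈ B := by
        by_contra hxB
        exact hx.2.2 (hside x ⟨hxA, hxB⟩).2
      simp only [f, if_pos hxA]
      exact Or.inl ⟨x, ⟨hx.2, hxA, hxB⟩, rfl⟩
    · have hxB : x ∈ B \ A := ⟨(hA x).resolve_left hxA, hxA⟩
      simp only [f, if_neg hxA]
      refine Or.inr ⟨_, ⟨mk_mem_sepEdges hx.1 hv hxB, ?_, x, Sym2.mem_mk_right v x,
        Or.inr ⟨hxB, hx.2⟩⟩, rfl⟩
      rintro ⟨-, a, b, hab, h⟩
      have hvab : v = a ∨ v = b := Sym2.mem_iff.1 (hab ▸ Sym2.mem_mk_left v x)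
      have hvCD := hside v hv
      rcases hvab with rfl | rfl <;>
        simp only [corner, mem_inter_iff, mem_sdiff] at h hvCD <;> tauto
  have hgsub : Sum.inl '' (G.neighborSet u ∩ (A \ B)) ⊆ link G C D A B := by
    rintro _ ⟨x, hx, rfl⟩
    exact Or.inl ⟨x, ⟨hx.2, hside x hx.2⟩, rfl⟩
  have hdisj : Disjoint (Sum.inl '' (G.neighborSet u ∩ (A \ B)))
      (f '' (G.neighborSet v ∩ (C \ D))) := by
    rw [Set.disjoint_left]
    rintro _ ⟨x, hx, rfl⟩ ⟨y, hy, hxy⟩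
    simp only [f] at hxy
    split_ifs at hxy
    rw [Sum.inl.injEq] at hxy
    exact hy.2.2 (hxy ▸ (hside x hx.2).2)
  calc (4 : ℕ∞) = 2 + 2 := by norm_num
    _ ≤ (G.neighborSet u ∩ (A \ B)).encard + (G.neighborSet v ∩ (C \ D)).encard :=
        add_le_add hM hN
    _ = (Sum.inl '' (G.neighborSet u ∩ (A \ B)) ∪
          f '' (G.neighborSet v ∩ (C \ D))).encard := by
        rw [Set.encard_union_eq hdisj, hf.encard_image, Sum.inl_injective.encard_image]
    _ ≤ _ := Set.encard_le_encard fun x hx =>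
        Or.inl (Or.inl (hx.imp (fun h => hgsub h) (fun h => hfsub h)))

theorem four_le_encard_cornerSep_or {G : SimpleGraph V} {A B C D : Set V} (hG : KConnected G 4)
    (hAB : IsTetraSep G A B) (hCD : IsTetraSep G C D) (hDC : IsMixedSep D C) :
    4 ≤ (cornerSep G A B C D).encard ∨ 4 ≤ (cornerSep G A B D C).encard := by
  rcases (corner A B C D).eq_empty_or_nonempty with hAC | hAC
  · rcases (corner A B D C).eq_empty_or_nonempty with hAD | hAD
    · exact Or.inl (four_le_encard_cornerSep_of_corners_empty hAB hCD hAC hAD)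
    · exact Or.inr (hG.le_encard_cornerSep hAB.1 hDC hAD)
  · exact Or.inl (hG.le_encard_cornerSep hAB.1 hCD.1 hAC)

theorem IsMixedSep.symm {A B : Set V} (h : IsMixedSep A B) : IsMixedSep B A :=
  ⟨union_comm A B ▸ h.1, h.2.2, h.2.1⟩

theorem IsTetraSep.symm {G : SimpleGraph V} {A B : Set V} (h : IsTetraSep G A B) :
    IsTetraSep G B A := by
  refine ⟨h.1.symm, ?_, fun v hv => (h.2.2.1 v hv.symm).symm, ?_⟩
  · rw [sepOrder, inter_comm, sepEdges_comm]; exact h.2.1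
  · rw [MatchingCondition, sepEdges_comm]; exact h.2.2.2

/-- crossing tetra-separations admit two opposite corner-separators of
size at least 4. -/
theorem crossing_opposite_corners (G : SimpleGraph V) (A B C D : Set V)
    (hG : KConnected G 4)
    (hAB : IsTetraSep G A B) (hCD : IsTetraSep G C D) (hcross : Crosses A B C D) :
    (4 ≤ (cornerSep G A B C D).encard ∧ 4 ≤ (cornerSep G B A D C).encard) ∨
      (4 ≤ (cornerSep G A B D C).encard ∧ 4 ≤ (cornerSep G B A C D).encard) := by
  have h₁ := four_le_encard_cornerSep_or hG hAB hCD hCD.1.symm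
  have h₂ := four_le_encard_cornerSep_or hG hAB.symm hCD hCD.1.symm
  have h₃ := four_le_encard_cornerSep_or hG hCD hAB hAB.1.symm
  have h₄ := four_le_encard_cornerSep_or hG hCD.symm hAB hAB.1.symm
  rw [cornerSep_comm G C D A B, cornerSep_comm G C D B A] at h₃
  rw [cornerSep_comm G D C A B, cornerSep_comm G D C B A] at h₄
  tauto
end Paper
end
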